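/- arXiv:2104.11346 — 3 statements merged into one kernel-verified Lean document; each statement's English description precedes it below -/
import Mathlib

section
/- For every κ > 0 and all η₁, η₂ ∈ ℝ: (1/(2π)) ∫_ℝ dη₃ / [ (η₃² + κ²) ((η₃ − η₂)² + κ²) ((η₃ − η₁ − η₂)² + κ²) ] = (12κ² + η₁² + η₁η₂ + η₂²) / [ κ (η₁² + 4κ²) (η₂² + 4κ²) ((η₁ + η₂)² + 4κ²) ]. -/
open MeasureTheory

open Filter Topology

lemma tendsto_log_resolvent_ratio {κ : ℝ} (hκ : 0 < κ) (a b : ℝ) {l : Filter ℝ}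
    (hl : l ≤ Bornology.cobounded ℝ) :
    Tendsto (fun x : ℝ => Real.log (((x - a) ^ 2 + κ ^ 2) / ((x - b) ^ 2 + κ ^ 2))) l (𝓝 0) := by
  have hu : Tendsto (fun x : ℝ => x⁻¹) l (𝓝 0) := tendsto_inv₀_cobounded.mono_left hl
  have hne : ∀ᶠ x in l, x ≠ 0 := hl (Bornology.eventually_ne_cobounded 0)
  have hc : ContinuousAt (fun u : ℝ => Real.log (((1 - a * u) ^ 2 + κ ^ 2 * u ^ 2) /
      ((1 - b * u) ^ 2 + κ ^ 2 * u ^ 2))) 0 := by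
    refine ContinuousAt.log (ContinuousAt.div (by fun_prop) (by fun_prop) ?_) ?_ <;> simp
  have h := hc.tendsto.comp hu
  simp only [mul_zero, sub_zero, one_pow, ne_eq, OfNat.ofNat_ne_zero, not_false_eq_true, zero_pow,
    add_zero, div_one, Real.log_one] at h
  refine h.congr' ?_
  filter_upwards [hne] with x hx
  have h1 : (x - b) ^ 2 + κ ^ 2 ≠ 0 := by positivity
  have h2 : (1 - b * x⁻¹) ^ 2 + κ ^ 2 * x⁻¹ ^ 2 ≠ 0 := by positivity
  simp only [Function.comp_apply]
  congr 1
  rw [div_eq_div_iff h2 h1]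
  field_simp

lemma integrable_resolvent {κ : ℝ} (hκ : 0 < κ) (a : ℝ) :
    Integrable (fun x : ℝ => 1 / ((x - a) ^ 2 + κ ^ 2)) := by
  have h := ((integrable_inv_one_add_sq.comp_div hκ.ne').comp_sub_right a).const_mul (κ ^ 2)⁻¹
  refine h.congr (Eventually.of_forall fun x => ?_)
  have : (x - a) ^ 2 + κ ^ 2 ≠ 0 := by positivity
  have : 1 + ((x - a) / κ) ^ 2 ≠ 0 := by positivity
  have := hκ.ne'
  field_simp
  ring

lemma integrable_resolvent_mul_resolvent {κ : ℝ} (hκ : 0 < κ) (a b : ℝ) :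
    Integrable (fun x : ℝ => 1 / (((x - a) ^ 2 + κ ^ 2) * ((x - b) ^ 2 + κ ^ 2))) := by
  refine ((integrable_resolvent hκ a).const_mul (κ ^ 2)⁻¹).mono' ?_
    (Eventually.of_forall fun x => ?_)
  · refine Continuous.aestronglyMeasurable ?_
    refine continuous_const.div (by fun_prop) fun x => by positivity
  · rw [Real.norm_of_nonneg (by positivity), ← one_div, one_div_mul_one_div, mul_comm]
    gcongr
    nlinarith [sq_nonneg (x - b)]

lemma integral_resolvent_mul_resolvent {κ : ℝ} (hκ : 0 < κ) {a b : ℝ} (hab : a ≠ b) :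
    ∫ x : ℝ, 1 / (((x - a) ^ 2 + κ ^ 2) * ((x - b) ^ 2 + κ ^ 2)) =
      2 * Real.pi / (κ * ((a - b) ^ 2 + 4 * κ ^ 2)) := by
  have hd : b - a ≠ 0 := sub_ne_zero.2 hab.symm
  have hK : (a - b) ^ 2 + 4 * κ ^ 2 ≠ 0 := by positivity
  let F : ℝ → ℝ := fun x =>
    1 / ((b - a) * ((a - b) ^ 2 + 4 * κ ^ 2)) *
        Real.log (((x - a) ^ 2 + κ ^ 2) / ((x - b) ^ 2 + κ ^ 2)) +
      1 / (κ * ((a - b) ^ 2 + 4 * κ ^ 2)) *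
        (Real.arctan ((x - a) / κ) + Real.arctan ((x - b) / κ))
  have hF (x : ℝ) : HasDerivAt F
      (1 / (((x - a) ^ 2 + κ ^ 2) * ((x - b) ^ 2 + κ ^ 2))) x := by
    have ha : (x - a) ^ 2 + κ ^ 2 ≠ 0 := by positivity
    have hb : (x - b) ^ 2 + κ ^ 2 ≠ 0 := by positivity
    have hq (c : ℝ) : HasDerivAt (fun y : ℝ => (y - c) ^ 2 + κ ^ 2) (2 * (x - c)) x := by
      simpa using (((hasDerivAt_id x).sub_const c).pow 2).add_const (κ ^ 2)
    have ht (c : ℝ) : HasDerivAt (fun y : ℝ => Real.arctan ((y - c) / κ))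
        (1 / (1 + ((x - c) / κ) ^ 2) * (1 / κ)) x :=
      (((hasDerivAt_id x).sub_const c).div_const κ).arctan
    have hta (c : ℝ) : 1 / (1 + ((x - c) / κ) ^ 2) * (1 / κ) = κ / ((x - c) ^ 2 + κ ^ 2) := by
      have : (x - c) ^ 2 + κ ^ 2 ≠ 0 := by positivity
      have : 1 + ((x - c) / κ) ^ 2 ≠ 0 := by positivity
      field_simp
      ring
    have h := ((((hq a).div (hq b) hb).log (div_ne_zero ha hb)).const_mul
      (1 / ((b - a) * ((a - b) ^ 2 + 4 * κ ^ 2)))).add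
      (((ht a).add (ht b)).const_mul (1 / (κ * ((a - b) ^ 2 + 4 * κ ^ 2))))
    refine h.congr_deriv ?_
    rw [hta, hta, Pi.div_apply]
    field_simp
    ring
  have htop (c : ℝ) : Tendsto (fun x : ℝ => (x - c) / κ) atTop atTop :=
    (tendsto_atTop_add_const_right _ (-c) tendsto_id).atTop_div_const hκ
  have hbot (c : ℝ) : Tendsto (fun x : ℝ => (x - c) / κ) atBot atBot :=
    (tendsto_atBot_add_const_right _ (-c) tendsto_id).atBot_div_const hκ
  have hT (c : ℝ) := (Real.tendsto_arctan_atTop.mono_right nhdsWithin_le_nhds).comp (htop c)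
  have hB (c : ℝ) := (Real.tendsto_arctan_atBot.mono_right nhdsWithin_le_nhds).comp (hbot c)
  have hFT := ((tendsto_log_resolvent_ratio hκ a b
      IsOrderBornology.atTop_le_cobounded).const_mul
      (1 / ((b - a) * ((a - b) ^ 2 + 4 * κ ^ 2)))).add
    (((hT a).add (hT b)).const_mul (1 / (κ * ((a - b) ^ 2 + 4 * κ ^ 2))))
  have hFB := ((tendsto_log_resolvent_ratio hκ a b
      IsOrderBornology.atBot_le_cobounded).const_mul
      (1 / ((b - a) * ((a - b) ^ 2 + 4 * κ ^ 2)))).add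
    (((hB a).add (hB b)).const_mul (1 / (κ * ((a - b) ^ 2 + 4 * κ ^ 2))))
  rw [integral_of_hasDerivAt_of_tendsto hF (integrable_resolvent_mul_resolvent hκ a b) hFB hFT]
  field_simp
  ring

lemma integral_resolvent_mul_resolvent_mul_resolvent {κ : ℝ} (hκ : 0 < κ) {a b c : ℝ}
    (hab : a ≠ b) (hbc : b ≠ c) (hac : a ≠ c) :
    ∫ x : ℝ, 1 / (((x - a) ^ 2 + κ ^ 2) * ((x - b) ^ 2 + κ ^ 2) * ((x - c) ^ 2 + κ ^ 2)) =
      1 / ((a - b) * (a - c)) * (2 * Real.pi / (κ * ((b - c) ^ 2 + 4 * κ ^ 2))) +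
      1 / ((b - a) * (b - c)) * (2 * Real.pi / (κ * ((a - c) ^ 2 + 4 * κ ^ 2))) +
      1 / ((c - a) * (c - b)) * (2 * Real.pi / (κ * ((a - b) ^ 2 + 4 * κ ^ 2))) := by
  have hI := integrable_resolvent_mul_resolvent hκ
  rw [← integral_resolvent_mul_resolvent hκ hab, ← integral_resolvent_mul_resolvent hκ hbc,
    ← integral_resolvent_mul_resolvent hκ hac, ← integral_const_mul, ← integral_const_mul,
    ← integral_const_mul, ← integral_add ((hI b c).const_mul _) ((hI a c).const_mul _),
    ← integral_add ?_ ((hI a b).const_mul _)]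
  swap
  · exact ((hI b c).const_mul _).add ((hI a c).const_mul _)
  congr 1
  ext x
  have h1 : (x - a) ^ 2 + κ ^ 2 ≠ 0 := by positivity
  have h2 : (x - b) ^ 2 + κ ^ 2 ≠ 0 := by positivity
  have h3 : (x - c) ^ 2 + κ ^ 2 ≠ 0 := by positivity
  have hab' := sub_ne_zero.2 hab
  have hbc' := sub_ne_zero.2 hbc
  have hac' := sub_ne_zero.2 hac
  rw [← neg_sub a b, ← neg_sub a c, ← neg_sub b c]
  field_simp
  ring

lemma continuous_integral_triple_resolvent {κ : ℝ} (hκ : 0 < κ) :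
    Continuous (fun p : ℝ × ℝ => ∫ x : ℝ, 1 / ((x ^ 2 + κ ^ 2) * ((x - p.2) ^ 2 + κ ^ 2)
      * ((x - p.1 - p.2) ^ 2 + κ ^ 2))) := by
  refine continuous_of_dominated
    (bound := fun x => 1 / ((x - 0) ^ 2 + κ ^ 2) * (1 / (κ ^ 2 * κ ^ 2))) (fun p => ?_)
    (fun p => Eventually.of_forall fun x => ?_)
    ((integrable_resolvent hκ 0).mul_const _) (Eventually.of_forall fun x => ?_)
  · refine Continuous.aestronglyMeasurable ?_
    exact continuous_const.div (by fun_prop) fun x => by positivity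
  · rw [Real.norm_of_nonneg (by positivity), one_div_mul_one_div, sub_zero, mul_assoc]
    gcongr
    · nlinarith [sq_nonneg (x - p.2)]
    · nlinarith [sq_nonneg (x - p.1 - p.2)]
  · exact continuous_const.div (by fun_prop) fun p => by positivity

lemma triple_resolvent_integral_of_ne_zero {κ : ℝ} (hκ : 0 < κ) {s t : ℝ}
    (hs : s ≠ 0) (ht : t ≠ 0) (hst : s + t ≠ 0) :
    (1 / (2 * Real.pi)) *
        ∫ x : ℝ, 1 / ((x ^ 2 + κ ^ 2) * ((x - t) ^ 2 + κ ^ 2) * ((x - s - t) ^ 2 + κ ^ 2)) =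
      (12 * κ ^ 2 + s ^ 2 + s * t + t ^ 2) /
        (κ * (s ^ 2 + 4 * κ ^ 2) * (t ^ 2 + 4 * κ ^ 2) * ((s + t) ^ 2 + 4 * κ ^ 2)) := by
  have h := integral_resolvent_mul_resolvent_mul_resolvent hκ (a := 0) (b := t) (c := s + t)
    ht.symm (by simpa using hs) hst.symm
  have hπ := Real.pi_ne_zero
  have h1 : s ^ 2 + 4 * κ ^ 2 ≠ 0 := by positivity
  have h2 : t ^ 2 + 4 * κ ^ 2 ≠ 0 := by positivity
  have h3 : (s + t) ^ 2 + 4 * κ ^ 2 ≠ 0 := by positivity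
  simp only [sub_zero, zero_sub, neg_sq, sub_add_cancel_right, add_sub_cancel_right,
    ← sub_sub] at h
  rw [h, ← neg_add', neg_sq]
  field_simp
  ring

/-- Exact evaluation of the internal-frequency integral of three resolvent symbols:
`(1/2π) ∫ dη₃ /[(η₃²+κ²)((η₃−η₂)²+κ²)((η₃−η₁−η₂)²+κ²)]
  = (12κ²+η₁²+η₁η₂+η₂²)/[κ(η₁²+4κ²)(η₂²+4κ²)((η₁+η₂)²+4κ²)]`. -/
theorem triple_resolvent_integral (κ : ℝ) (hκ : 0 < κ) (η₁ η₂ : ℝ) :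
    (1 / (2 * Real.pi)) *
        ∫ η₃ : ℝ, 1 / ((η₃ ^ 2 + κ ^ 2) * ((η₃ - η₂) ^ 2 + κ ^ 2)
            * ((η₃ - η₁ - η₂) ^ 2 + κ ^ 2))
      = (12 * κ ^ 2 + η₁ ^ 2 + η₁ * η₂ + η₂ ^ 2) /
          (κ * (η₁ ^ 2 + 4 * κ ^ 2) * (η₂ ^ 2 + 4 * κ ^ 2)
            * ((η₁ + η₂) ^ 2 + 4 * κ ^ 2)) := by
  let L : ℝ × ℝ → ℝ := fun p => (1 / (2 * Real.pi)) *
    ∫ x : ℝ, 1 / ((x ^ 2 + κ ^ 2) * ((x - p.2) ^ 2 + κ ^ 2) * ((x - p.1 - p.2) ^ 2 + κ ^ 2))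
  let R : ℝ × ℝ → ℝ := fun p => (12 * κ ^ 2 + p.1 ^ 2 + p.1 * p.2 + p.2 ^ 2) /
    (κ * (p.1 ^ 2 + 4 * κ ^ 2) * (p.2 ^ 2 + 4 * κ ^ 2) * ((p.1 + p.2) ^ 2 + 4 * κ ^ 2))
  have hL : Continuous L := continuous_const.mul (continuous_integral_triple_resolvent hκ)
  have hR : Continuous R := Continuous.div (by fun_prop) (by fun_prop) fun p => by positivity
  let γ : ℝ → ℝ × ℝ := fun t => (η₁ + t, η₂ + t)
  have hγ : Tendsto γ (𝓝[≠] 0) (𝓝 (η₁, η₂)) := by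
    have : Continuous γ := by fun_prop
    simpa [γ] using (this.tendsto 0).mono_left nhdsWithin_le_nhds
  have hne (c : ℝ) : ∀ᶠ t in 𝓝[≠] (0 : ℝ), t ≠ c := by
    rcases eq_or_ne c 0 with rfl | hc
    · exact self_mem_nhdsWithin
    · exact nhdsWithin_le_nhds (isOpen_ne.mem_nhds hc.symm)
  have hEq : L ∘ γ =ᶠ[𝓝[≠] 0] R ∘ γ := by
    filter_upwards [hne (-η₁), hne (-η₂), hne (-(η₁ + η₂) / 2)] with t h1 h2 h3
    refine triple_resolvent_integral_of_ne_zero hκ (fun h => h1 ?_) (fun h => h2 ?_)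
      (fun h => h3 ?_) <;> linarith
  change L (η₁, η₂) = R (η₁, η₂)
  exact tendsto_nhds_unique ((hL.tendsto (η₁, η₂)).comp hγ)
    (((hR.tendsto (η₁, η₂)).comp hγ).congr' hEq.symm)
end

section
/- There exists a constant C > 0 such that for every κ ≥ 1 and all η₁, η₂ ∈ ℝ: | 32κ⁴ (12κ² + η₁² + η₁η₂ + η₂²) / [ (η₁² + 4κ²) (η₂² + 4κ²) ((η₁ + η₂)² + 4κ²) ] − 6 | ≤ C (η₁² + η₂²)/κ². -/
/-- Cancellation of the quadratic symbol of the `H_κ` flow against its limit `6`: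
`|32κ⁴(12κ²+η₁²+η₁η₂+η₂²)/[(η₁²+4κ²)(η₂²+4κ²)((η₁+η₂)²+4κ²)] − 6| ≤ C(η₁²+η₂²)/κ²`. -/
theorem quadratic_symbol_cancellation :
    ∃ C > 0, ∀ κ : ℝ, 1 ≤ κ → ∀ η₁ η₂ : ℝ,
      |32 * κ ^ 4 * (12 * κ ^ 2 + η₁ ^ 2 + η₁ * η₂ + η₂ ^ 2) /
          ((η₁ ^ 2 + 4 * κ ^ 2) * (η₂ ^ 2 + 4 * κ ^ 2) * ((η₁ + η₂) ^ 2 + 4 * κ ^ 2)) - 6|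
        ≤ C * (η₁ ^ 2 + η₂ ^ 2) / κ ^ 2 := by
  refine ⟨5, by norm_num, fun κ hκ a b => ?_⟩
  have hκ0 : 0 < κ := by linarith
  have hk : 0 < κ ^ 2 := by positivity
  generalize hD : (a ^ 2 + 4 * κ ^ 2) * (b ^ 2 + 4 * κ ^ 2) * ((a + b) ^ 2 + 4 * κ ^ 2) = D
  have hDpos : 0 < D := by rw [← hD]; positivity
  obtain ⟨S, hS⟩ : ∃ S, S = a ^ 2 + a * b + b ^ 2 := ⟨_, rfl⟩
  have hS0 : 0 ≤ S := by nlinarith [sq_nonneg (a + b), sq_nonneg a, sq_nonneg b]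
  have hS2 : 3 * S ≤ 5 * (a ^ 2 + b ^ 2) := by nlinarith [sq_nonneg (a - b), sq_nonneg a, sq_nonneg b]
  obtain ⟨e, he⟩ : ∃ e, e = (a * b * (a + b)) ^ 2 := ⟨_, rfl⟩
  have he0 : 0 ≤ e := by rw [he]; positivity
  -- the discriminant of the cubic with roots `a`, `b`, `-(a + b)` is a square
  have he1 : 27 * e ≤ 4 * S ^ 3 := by
    have : 4 * S ^ 3 - 27 * e = ((a - b) * (2 * a + b) * (a + 2 * b)) ^ 2 := by
      rw [hS, he]; ring
    linarith [sq_nonneg ((a - b) * (2 * a + b) * (a + 2 * b))]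
  obtain ⟨k, hkk⟩ : ∃ k, k = κ ^ 2 := ⟨_, rfl⟩
  have hk0 : 0 < k := hkk ▸ hk
  have hDe : D = 64 * k ^ 3 + 32 * k ^ 2 * S + 4 * k * S ^ 2 + e := by
    rw [← hD, hS, he, hkk]; ring
  have hquot : 32 * κ ^ 4 * (12 * κ ^ 2 + a ^ 2 + a * b + b ^ 2) / D - 6
      = -((160 * k ^ 2 * S + 24 * k * S ^ 2 + 6 * e) / D) := by
    rw [eq_comm, ← sub_eq_zero]
    field_simp
    rw [hDe, hS, he, hkk]
    ring
  rw [hquot, abs_neg, abs_of_nonneg (by positivity), ← hkk, div_le_div_iff₀ hDpos hk0]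
  calc (160 * k ^ 2 * S + 24 * k * S ^ 2 + 6 * e) * k
      ≤ 3 * S * D := by
        rw [hDe]
        have h1 : 0 ≤ k ^ 3 * S := by positivity
        have h2 : 0 ≤ k ^ 2 * S ^ 2 := by positivity
        have h3 : 0 ≤ k * S ^ 3 := by positivity
        have h4 : 0 ≤ S * e := by positivity
        have h5 := mul_le_mul_of_nonneg_left he1 hk0.le
        linarith
    _ ≤ 5 * (a ^ 2 + b ^ 2) * D := by gcongr
end

section
/- There exists a constant C > 0 such that for every κ ≥ 1 and all a, b ∈ ℝ, setting G(η) = 1 / [ (η² + κ²) ((η − a)² + κ²) ((η − b)² + κ²) ], one has | 2π ∑_{n∈ℤ} G(2πn) − ∫_ℝ G(η) dη | ≤ C κ^{−6}. -/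
open MeasureTheory

/-- The left-endpoint rule on a unit interval is controlled by the variation of the integrand. -/
theorem abs_sub_intervalIntegral_unit_le {g g' : ℝ → ℝ} (hg : ∀ x, HasDerivAt g (g' x) x)
    (hg' : Integrable g') (t : ℝ) :
    |g t - ∫ x in t..t + 1, g x| ≤ ∫ x in t..t + 1, |g' x| := by
  have hcont : Continuous g := continuous_iff_continuousAt.2 fun x => (hg x).continuousAt
  have hsub : g t - ∫ x in t..t + 1, g x = ∫ x in t..t + 1, (g t - g x) := by
    rw [intervalIntegral.integral_sub intervalIntegrable_const (hcont.intervalIntegrable _ _)]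
    simp
  have hbound : ∀ x ∈ Set.uIoc t (t + 1), ‖g t - g x‖ ≤ ∫ y in t..t + 1, |g' y| := by
    intro x hx
    rw [Set.uIoc_of_le (by linarith)] at hx
    have hftc : ∫ y in t..x, g' y = g x - g t :=
      intervalIntegral.integral_eq_sub_of_hasDerivAt (fun y _ => hg y) hg'.intervalIntegrable
    rw [norm_sub_rev, ← hftc]
    refine (intervalIntegral.abs_integral_le_integral_abs hx.1.le).trans ?_
    exact intervalIntegral.integral_mono_interval le_rfl hx.1.le hx.2
      (Filter.Eventually.of_forall fun y => abs_nonneg _) hg'.abs.intervalIntegrable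
  rw [hsub]
  simpa using intervalIntegral.norm_integral_le_of_norm_le_const hbound

/-- The sum over `ℤ` differs from the integral by at most the total variation. -/
theorem abs_tsum_int_sub_integral_le {g g' : ℝ → ℝ} (hg : ∀ x, HasDerivAt g (g' x) x)
    (hgi : Integrable g) (hg' : Integrable g') :
    |∑' n : ℤ, g n - ∫ x, g x| ≤ ∫ x, |g' x| := by
  have hsum := hgi.hasSum_intervalIntegral 0
  have hvar := hg'.abs.hasSum_intervalIntegral 0
  simp only [zero_add] at hsum hvar
  have hle (n : ℤ) := abs_sub_intervalIntegral_unit_le hg hg' n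
  have hdiff : Summable fun n : ℤ => g n - ∫ x in (n : ℝ)..n + 1, g x :=
    Summable.of_norm_bounded hvar.summable hle
  have hgs : Summable fun n : ℤ => g n := by
    simpa using hdiff.add hsum.summable
  rw [← hsum.tsum_eq, ← hgs.tsum_sub hsum.summable, ← Real.norm_eq_abs]
  exact tsum_of_norm_bounded hvar hle

/-- Comparison of the sum over the lattice `hℤ`, weighted by the mesh, with the integral. -/
theorem abs_mesh_mul_tsum_sub_integral_le {f f' : ℝ → ℝ} {h : ℝ} (hh : 0 < h)
    (hf : ∀ x, HasDerivAt f (f' x) x) (hfi : Integrable f) (hf' : Integrable f') :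
    |h * ∑' n : ℤ, f (h * n) - ∫ x, f x| ≤ h * ∫ x, |f' x| := by
  have hder (x : ℝ) : HasDerivAt (fun x => f (h * x)) (h * f' (h * x)) x := by
    have := (hf (h * x)).comp x ((hasDerivAt_id x).const_mul h)
    simpa [Function.comp_def, mul_comm] using this
  have key := abs_tsum_int_sub_integral_le hder (hfi.comp_mul_left' hh.ne')
    ((hf'.comp_mul_left' hh.ne').const_mul h)
  simp only [abs_mul, abs_of_pos hh, integral_const_mul] at key
  rw [Measure.integral_comp_mul_left, Measure.integral_comp_mul_left (fun x => |f' x|), abs_inv,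
    abs_of_pos hh, smul_eq_mul, smul_eq_mul, mul_inv_cancel_left₀ hh.ne'] at key
  calc |h * ∑' n : ℤ, f (h * n) - ∫ x, f x|
      = h * |∑' n : ℤ, f (h * n) - h⁻¹ * ∫ x, f x| := by
        rw [← abs_of_pos hh, ← abs_mul, abs_of_pos hh, mul_sub, mul_inv_cancel_left₀ hh.ne']
    _ ≤ h * ∫ x, |f' x| := by gcongr

theorem integrable_inv_sq_add_const_sq {κ : ℝ} (hκ : 0 < κ) :
    Integrable fun x : ℝ => (x ^ 2 + κ ^ 2)⁻¹ := by
  have := (integrable_inv_one_add_sq.comp_div hκ.ne').const_mul (κ ^ 2)⁻¹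
  refine this.congr (Filter.Eventually.of_forall fun x => ?_)
  have : x ^ 2 + κ ^ 2 ≠ 0 := by positivity
  simp only
  field_simp
  ring

theorem integral_univ_inv_sq_add_sq {κ : ℝ} (hκ : 0 < κ) :
    ∫ x : ℝ, (x ^ 2 + κ ^ 2)⁻¹ = Real.pi / κ := by
  have hscale : (fun x : ℝ => (x ^ 2 + κ ^ 2)⁻¹) =
      fun x => (κ ^ 2)⁻¹ * (1 + (x / κ) ^ 2)⁻¹ := by
    funext x
    have : x ^ 2 + κ ^ 2 ≠ 0 := by positivity
    field_simp
    ring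
  rw [hscale, integral_const_mul, Measure.integral_comp_div (fun x : ℝ => (1 + x ^ 2)⁻¹),
    integral_univ_inv_one_add_sq, abs_of_pos hκ, smul_eq_mul]
  field_simp

theorem hasDerivAt_inv_sq_add_sq {κ : ℝ} (hκ : 0 < κ) (c x : ℝ) :
    HasDerivAt (fun x : ℝ => ((x - c) ^ 2 + κ ^ 2)⁻¹)
      (-(2 * (x - c)) / ((x - c) ^ 2 + κ ^ 2) ^ 2) x := by
  have hne : (x - c) ^ 2 + κ ^ 2 ≠ 0 := by positivity
  simpa using ((((hasDerivAt_id x).sub_const c).pow 2).add_const (κ ^ 2)).fun_inv hne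

theorem abs_deriv_inv_sq_add_sq_le {κ : ℝ} (hκ : 0 < κ) (y : ℝ) :
    |-(2 * y) / (y ^ 2 + κ ^ 2) ^ 2| ≤ κ⁻¹ * (y ^ 2 + κ ^ 2)⁻¹ := by
  have hpos : 0 < y ^ 2 + κ ^ 2 := by positivity
  rw [abs_div, abs_neg, abs_mul, abs_two, abs_of_pos (pow_pos hpos 2), ← mul_inv,
    ← one_div, div_le_div_iff₀ (by positivity) (by positivity)]
  have : 2 * |y| * κ ≤ y ^ 2 + κ ^ 2 := by
    nlinarith [sq_nonneg (|y| - κ), sq_abs y]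
  nlinarith

theorem lattice_sum_integral_comparison :
    ∃ C > 0, ∀ κ : ℝ, 1 ≤ κ → ∀ a b : ℝ,
      |2 * Real.pi *
          (∑' n : ℤ, 1 / (((2 * Real.pi * (n : ℝ)) ^ 2 + κ ^ 2)
              * ((2 * Real.pi * (n : ℝ) - a) ^ 2 + κ ^ 2)
              * ((2 * Real.pi * (n : ℝ) - b) ^ 2 + κ ^ 2)))
        - ∫ η : ℝ, 1 / ((η ^ 2 + κ ^ 2) * ((η - a) ^ 2 + κ ^ 2) * ((η - b) ^ 2 + κ ^ 2))|
        ≤ C / κ ^ 6 := by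
  refine ⟨6 * Real.pi ^ 2, by positivity, fun κ hκ1 a b => ?_⟩
  have hκ : 0 < κ := by linarith
  set p : ℝ → ℝ → ℝ := fun c x => ((x - c) ^ 2 + κ ^ 2)⁻¹ with hp
  set p' : ℝ → ℝ → ℝ := fun c x => -(2 * (x - c)) / ((x - c) ^ 2 + κ ^ 2) ^ 2
  have hder (c x : ℝ) : HasDerivAt (p c) (p' c x) x := hasDerivAt_inv_sq_add_sq hκ c x
  have hbd (c x : ℝ) : |p' c x| ≤ κ⁻¹ * p c x := abs_deriv_inv_sq_add_sq_le hκ (x - c)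
  have hpos (c x : ℝ) : 0 < p c x := by positivity
  have hle (c x : ℝ) : p c x ≤ (κ ^ 2)⁻¹ :=
    inv_anti₀ (by positivity) (le_add_of_nonneg_left (sq_nonneg _))
  have hint : Integrable (p 0) := by simpa [hp] using integrable_inv_sq_add_const_sq hκ
  have hintegral : ∫ x, p 0 x = Real.pi / κ := by simpa [hp] using integral_univ_inv_sq_add_sq hκ
  set G : ℝ → ℝ := fun x => p 0 x * p a x * p b x with hG
  set G' : ℝ → ℝ := fun x => (p' 0 x * p a x + p 0 x * p' a x) * p b x + p 0 x * p a x * p' b x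
  have hGder (x : ℝ) : HasDerivAt G (G' x) x := ((hder 0 x).mul (hder a x)).mul (hder b x)
  have hpcont (c : ℝ) : Continuous (p c) :=
    continuous_iff_continuousAt.2 fun x => (hder c x).continuousAt
  have hp'cont (c : ℝ) : Continuous (p' c) :=
    Continuous.div (by fun_prop) (by fun_prop) fun x => by positivity
  have hGle (x : ℝ) : |G x| ≤ (κ ^ 4)⁻¹ * p 0 x := by
    rw [abs_of_pos (mul_pos (mul_pos (hpos 0 x) (hpos a x)) (hpos b x))]
    calc p 0 x * p a x * p b x
        ≤ p 0 x * (κ ^ 2)⁻¹ * (κ ^ 2)⁻¹ :=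
          mul_le_mul (mul_le_mul_of_nonneg_left (hle a x) (hpos 0 x).le) (hle b x)
            (hpos b x).le (by have := hpos 0 x; positivity)
      _ = (κ ^ 4)⁻¹ * p 0 x := by rw [mul_assoc, ← mul_inv, ← pow_add, mul_comm]
  have hG'le (x : ℝ) : |G' x| ≤ 3 * (κ ^ 5)⁻¹ * p 0 x := by
    have h0 := hpos 0 x
    have ha := hpos a x
    have hb := hpos b x
    calc |G' x|
        ≤ (|p' 0 x| * p a x + p 0 x * |p' a x|) * p b x + p 0 x * p a x * |p' b x| := by
          refine (abs_add_le _ _).trans ?_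
          rw [abs_mul, abs_mul (p 0 x * p a x), abs_of_pos hb, abs_of_pos (mul_pos h0 ha)]
          gcongr
          refine (abs_add_le _ _).trans ?_
          rw [abs_mul, abs_mul, abs_of_pos ha, abs_of_pos h0]
      _ ≤ (κ⁻¹ * p 0 x * p a x + p 0 x * (κ⁻¹ * p a x)) * p b x
            + p 0 x * p a x * (κ⁻¹ * p b x) := by
          gcongr <;> exact hbd _ _
      _ = 3 * κ⁻¹ * G x := by rw [hG]; ring
      _ ≤ 3 * κ⁻¹ * ((κ ^ 4)⁻¹ * p 0 x) := by
          gcongr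
          exact (le_abs_self _).trans (hGle x)
      _ = 3 * (κ ^ 5)⁻¹ * p 0 x := by rw [pow_succ κ 4, mul_inv]; ring
  have hGint : Integrable G :=
    (hint.const_mul _).mono' (by fun_prop) (Filter.Eventually.of_forall hGle)
  have hG'int : Integrable G' :=
    (hint.const_mul _).mono' (by fun_prop) (Filter.Eventually.of_forall hG'le)
  have key := abs_mesh_mul_tsum_sub_integral_le Real.two_pi_pos hGder hGint hG'int
  have hGeq (x : ℝ) :
      1 / ((x ^ 2 + κ ^ 2) * ((x - a) ^ 2 + κ ^ 2) * ((x - b) ^ 2 + κ ^ 2)) = G x := by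
    simp only [hG, hp, sub_zero, one_div, mul_inv]
  simp only [hGeq]
  calc _ ≤ 2 * Real.pi * ∫ x, |G' x| := key
    _ ≤ 2 * Real.pi * ∫ x, 3 * (κ ^ 5)⁻¹ * p 0 x := by
        refine mul_le_mul_of_nonneg_left ?_ Real.two_pi_pos.le
        exact integral_mono hG'int.abs (hint.const_mul _) hG'le
    _ = 6 * Real.pi ^ 2 / κ ^ 6 := by
        rw [integral_const_mul, hintegral]
        field_simp
        ring
end
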